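/- Let θ : W → W be a group automorphism mapping S onto itself, and let 𝒦 ⊆ W be a quasiparabolic θ-twisted conjugacy class. Then {x·θ(x) : x ∈ 𝒦} = {y⁻¹·θ(θ(y)) : y ∈ W}; that is, the map x ↦ x·θ(x) defines a surjection from 𝒦 onto the set of θ²-twisted identities. -/

import Mathlib

noncomputable section

variable {B W : Type*} [Group W] {M : CoxeterMatrix B}

/-- The `θ`-twisted conjugation action of `W` on itself: `w • x = w·x·θ(w)⁻¹`. -/
def twConj (θ : W ≃* W) (w x : W) : W := w * x * (θ w)⁻¹

/-- The height function `ht = ℓ/2` on `W`. -/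
def htL (cs : CoxeterSystem M W) (x : W) : ℚ := (cs.length x : ℚ) / 2

/-- `𝒦` is a `θ`-twisted conjugacy class, i.e. an orbit of the twisted conjugation action. -/
def IsTwClass (θ : W ≃* W) (𝒦 : Set W) : Prop :=
  ∃ x₀ : W, 𝒦 = Set.range fun w => twConj θ w x₀

/-- The `θ`-twisted conjugacy class `𝒦` is quasiparabolic with respect to the height
function `ht = ℓ/2`: (QP1) and (QP2) hold. -/
def IsQPClass (cs : CoxeterSystem M W) (θ : W ≃* W) (𝒦 : Set W) : Prop :=
  (∀ r : W, cs.IsReflection r → ∀ x ∈ 𝒦,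
      htL cs (twConj θ r x) = htL cs x → twConj θ r x = x) ∧
  (∀ r : W, cs.IsReflection r → ∀ x ∈ 𝒦, ∀ i : B,
      htL cs x < htL cs (twConj θ r x) →
      htL cs (twConj θ (cs.simple i) (twConj θ r x)) < htL cs (twConj θ (cs.simple i) x) →
      twConj θ r x = twConj θ (cs.simple i) x)

/-- `x` is a `W`-minimal element: `ℓ(s·x·θ(s)⁻¹) ≥ ℓ(x)` for all simple reflections `s`. -/
def TwMin (cs : CoxeterSystem M W) (θ : W ≃* W) (x : W) : Prop :=
  ∀ i : B, cs.length x ≤ cs.length (twConj θ (cs.simple i) x)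

/-- The automorphism `θ` maps the set `S` of simple reflections onto itself. -/
def SimpleOnto (cs : CoxeterSystem M W) (θ : W ≃* W) : Prop :=
  ⇑θ '' Set.range cs.simple = Set.range cs.simple

namespace CoxeterSystem

open Classical in
/-- The action of a simple reflection on `W × ZMod 2` that conjugates the first component and
records in the second whether that component is the simple reflection itself. -/
def signedConj (cs : CoxeterSystem M W) (i : B) : Function.End (W × ZMod 2) :=
  fun p => (cs.simple i * p.1 * cs.simple i, p.2 + if p.1 = cs.simple i then 1 else 0)

open Classical in
theorem signedConj_mul_pow (cs : CoxeterSystem M W) (i j : B) (m : ℕ) (p : W × ZMod 2) :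
    ((cs.signedConj i * cs.signedConj j) ^ m) p =
      ((cs.simple i * cs.simple j) ^ m * p.1 * ((cs.simple i * cs.simple j) ^ m)⁻¹,
        p.2 + ∑ k ∈ Finset.range (2 * m),
          if p.1 = ((cs.simple i * cs.simple j) ^ k)⁻¹ * cs.simple j then 1 else 0) := by
  induction m with
  | zero => simp; rfl
  | succ m ih =>
    set c := cs.simple i * cs.simple j with hc
    have hjc : cs.simple j * c ^ m = (c ^ m)⁻¹ * cs.simple j := by
      have h : SemiconjBy (cs.simple j) c c⁻¹ := by
        simp [SemiconjBy, hc, mul_assoc]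
      simpa using (h.pow_right m).eq
    have h1 : c ^ m * p.1 * (c ^ m)⁻¹ = cs.simple j ↔
        p.1 = (c ^ (2 * m))⁻¹ * cs.simple j := by
      rw [mul_inv_eq_iff_eq_mul, hjc, ← eq_inv_mul_iff_mul_eq, two_mul, pow_add, mul_inv_rev,
        mul_assoc]
    have h2 : cs.simple j * (c ^ m * p.1 * (c ^ m)⁻¹) * cs.simple j = cs.simple i ↔
        p.1 = (c ^ (2 * m + 1))⁻¹ * cs.simple j := by
      have h3 : cs.simple j * (c ^ m * p.1 * (c ^ m)⁻¹) * cs.simple j = cs.simple i ↔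
          c ^ m * p.1 * (c ^ m)⁻¹ = c⁻¹ * cs.simple j := by
        constructor
        · intro h
          have h' := congrArg (fun w => cs.simple j * w * cs.simple j) h
          simp only [mul_assoc, simple_mul_simple_cancel_left, simple_mul_simple_self,
            mul_one] at h'
          rw [hc, mul_inv_rev, inv_simple, inv_simple]
          simpa only [mul_assoc] using h'
        · intro h
          rw [h, hc]
          simp [mul_assoc]
      rw [h3, mul_inv_eq_iff_eq_mul, mul_assoc, hjc, ← eq_inv_mul_iff_mul_eq]
      have : (c ^ (2 * m + 1))⁻¹ = (c ^ m)⁻¹ * (c⁻¹ * (c ^ m)⁻¹) := by group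
      rw [this]
      simp only [mul_assoc]
    have hpow : ((cs.signedConj i * cs.signedConj j) ^ (m + 1)) p =
        cs.signedConj i (cs.signedConj j (((cs.signedConj i * cs.signedConj j) ^ m) p)) := by
      rw [pow_succ']; rfl
    rw [hpow, ih, show 2 * (m + 1) = 2 * m + 1 + 1 by ring, Finset.sum_range_succ,
      Finset.sum_range_succ]
    simp only [signedConj, h1, h2, Prod.mk.injEq]
    refine ⟨?_, by ring⟩
    rw [pow_succ' c m, mul_inv_rev, hc, mul_inv_rev, inv_simple, inv_simple]
    simp only [mul_assoc]

theorem isLiftable_signedConj (cs : CoxeterSystem M W) : M.IsLiftable cs.signedConj := by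
  classical
  intro i j
  funext p
  rw [signedConj_mul_pow, two_mul, Finset.sum_range_add]
  simp [pow_add, CharTwo.add_self_eq_zero]
  rfl

/-- The action of `W` on `W × ZMod 2` in which simple reflections act by `signedConj`. -/
def signedConjHom (cs : CoxeterSystem M W) : W →* Function.End (W × ZMod 2) :=
  cs.lift ⟨cs.signedConj, cs.isLiftable_signedConj⟩

theorem signedConjHom_simple (cs : CoxeterSystem M W) (i : B) :
    cs.signedConjHom (cs.simple i) = cs.signedConj i :=
  cs.lift_apply_simple cs.isLiftable_signedConj i

open Classical in
theorem signedConjHom_wordProd (cs : CoxeterSystem M W) (ω : List B) (p : W × ZMod 2) :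
    cs.signedConjHom (cs.wordProd ω) p =
      (cs.wordProd ω * p.1 * (cs.wordProd ω)⁻¹, p.2 + ((cs.rightInvSeq ω).count p.1 : ZMod 2)) := by
  induction ω with
  | nil => simp; rfl
  | cons i ω ih =>
    rw [wordProd_cons, map_mul, signedConjHom_simple]
    change cs.signedConj i (cs.signedConjHom (cs.wordProd ω) p) = _
    rw [ih]
    have h : cs.wordProd ω * p.1 * (cs.wordProd ω)⁻¹ = cs.simple i ↔
        (cs.wordProd ω)⁻¹ * cs.simple i * cs.wordProd ω = p.1 := by
      rw [mul_inv_eq_iff_eq_mul, mul_assoc, inv_mul_eq_iff_eq_mul, eq_comm]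
    simp only [signedConj, rightInvSeq, List.count_cons, h, beq_iff_eq, mul_inv_rev, inv_simple,
      Prod.mk.injEq]
    refine ⟨by simp only [mul_assoc], ?_⟩
    push_cast
    ring

/-- The exchange property for right descents. -/
theorem IsRightDescent.exists_mul_simple_eq_eraseIdx {cs : CoxeterSystem M W} {ω : List B} {i : B}
    (h : cs.IsRightDescent (cs.wordProd ω) i) :
    ∃ j < ω.length, cs.wordProd ω * cs.simple i = cs.wordProd (ω.eraseIdx j) := by
  classical
  obtain ⟨ω', hω', hprod⟩ := cs.exists_isReduced (cs.wordProd ω * cs.simple i)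
  have hw : cs.wordProd (ω'.concat i) = cs.wordProd ω := by
    rw [wordProd_concat, ← hprod, simple_mul_simple_cancel_right]
  have hred : cs.IsReduced (ω'.concat i) := by
    have := hω'.eq
    rw [← hprod] at this
    rw [IsReduced, hw, List.length_concat, ← this, cs.isRightDescent_iff.mp h]
  have hcount : (cs.rightInvSeq (ω'.concat i)).count (cs.simple i) = 1 := by
    refine List.count_eq_one_of_mem hred.nodup_rightInvSeq ?_
    rw [rightInvSeq_concat]
    simp
  have heq := cs.signedConjHom_wordProd (ω'.concat i) (cs.simple i, 0)
  rw [hw, signedConjHom_wordProd, hcount, Prod.mk.injEq] at heq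
  have hmem : cs.simple i ∈ cs.rightInvSeq ω := by
    by_contra hn
    simp [List.count_eq_zero_of_not_mem hn] at heq
  obtain ⟨j, hj, hji⟩ := List.getElem_of_mem hmem
  refine ⟨j, by simpa using hj, ?_⟩
  rw [← wordProd_mul_getD_rightInvSeq, List.getD_eq_getElem _ _ hj, hji]

/-- The exchange property for left descents. -/
theorem IsLeftDescent.exists_simple_mul_eq_eraseIdx {cs : CoxeterSystem M W} {ω : List B} {i : B}
    (h : cs.IsLeftDescent (cs.wordProd ω) i) :
    ∃ j < ω.length, cs.simple i * cs.wordProd ω = cs.wordProd (ω.eraseIdx j) := by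
  rw [← isRightDescent_inv_iff, ← wordProd_reverse] at h
  obtain ⟨j, hj, h⟩ := h.exists_mul_simple_eq_eraseIdx
  rw [List.length_reverse] at hj
  refine ⟨ω.length - j - 1, by omega, ?_⟩
  have hrev : ω.reverse.eraseIdx j = (ω.eraseIdx (ω.length - j - 1)).reverse := by
    rw [List.eraseIdx_eq_take_drop_succ, List.eraseIdx_eq_take_drop_succ, List.take_reverse,
      List.drop_reverse, List.reverse_append, show ω.length - j - 1 + 1 = ω.length - j by omega,
      Nat.sub_sub]
  rw [hrev] at h
  simpa [wordProd_reverse] using congrArg (·⁻¹) h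

/-- A reduced word in the left descents of `x` is a prefix of some reduced word for `x`. -/
theorem IsReduced.exists_append_of_isLeftDescent {cs : CoxeterSystem M W} {x : W} {u : List B}
    (hu : cs.IsReduced u) (hd : ∀ i ∈ u, cs.IsLeftDescent x i) :
    ∃ v : List B, cs.wordProd (u ++ v) = x ∧ u.length + v.length = cs.length x := by
  induction u with
  | nil =>
    obtain ⟨v, hv, rfl⟩ := cs.exists_isReduced x
    exact ⟨v, by simp, by simpa using hv.eq.symm⟩
  | cons i u ih =>
    obtain ⟨v, rfl, hlen⟩ := ih (by simpa using hu.drop 1) fun k hk => hd k (by simp [hk])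
    obtain ⟨j, hj, hex⟩ := (hd i (by simp)).exists_simple_mul_eq_eraseIdx
    rw [List.length_append] at hj
    rcases lt_or_ge j u.length with hju | hju
    · exfalso
      rw [List.eraseIdx_append_of_lt_length hju, wordProd_append, wordProd_append, ← mul_assoc,
        mul_left_inj, ← wordProd_cons] at hex
      have h1 := hu.eq
      have h2 := cs.length_wordProd_le (u.eraseIdx j)
      rw [hex] at h1
      rw [List.length_eraseIdx_of_lt hju] at h2
      simp only [List.length_cons] at h1
      omega
    · rw [List.eraseIdx_append_of_length_le hju] at hex
      refine ⟨v.eraseIdx (j - u.length), ?_, ?_⟩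
      · rw [List.cons_append, wordProd_cons, ← hex, simple_mul_simple_cancel_left]
      · rw [← hlen, List.length_eraseIdx_of_lt (by omega), List.length_cons]
        omega

/-- An element all of whose letters (in some reduced word) are left descents is an involution. -/
theorem IsReduced.wordProd_mul_self {cs : CoxeterSystem M W} {ω : List B} (hω : cs.IsReduced ω)
    (hd : ∀ i ∈ ω, cs.IsLeftDescent (cs.wordProd ω) i) :
    cs.wordProd ω * cs.wordProd ω = 1 := by
  obtain ⟨v, hv, hlen⟩ := hω.reverse.exists_append_of_isLeftDescent (x := cs.wordProd ω)
    fun i hi => hd i (List.mem_reverse.mp hi)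
  have hv0 : v = [] := by
    rw [hω.eq, List.length_reverse] at hlen
    exact List.eq_nil_of_length_eq_zero (by omega)
  rw [hv0, List.append_nil, wordProd_reverse] at hv
  nth_rewrite 1 [← hv]
  simp

end CoxeterSystem

theorem twConj_mul (θ : W ≃* W) (v w x : W) :
    twConj θ (v * w) x = twConj θ v (twConj θ w x) := by
  simp [twConj, mul_assoc]

theorem IsTwClass.twConj_mem {θ : W ≃* W} {𝒦 : Set W} (hK : IsTwClass θ 𝒦) {x : W} (hx : x ∈ 𝒦)
    (w : W) : twConj θ w x ∈ 𝒦 := by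
  obtain ⟨x₀, rfl⟩ := hK
  obtain ⟨v, rfl⟩ := hx
  exact ⟨w * v, twConj_mul θ w v x₀⟩

theorem IsTwClass.eq_range {θ : W ≃* W} {𝒦 : Set W} (hK : IsTwClass θ 𝒦) {x : W} (hx : x ∈ 𝒦) :
    𝒦 = Set.range fun w => twConj θ w x := by
  refine Set.Subset.antisymm ?_ (Set.range_subset_iff.mpr fun w => hK.twConj_mem hx w)
  obtain ⟨x₀, rfl⟩ := hK
  obtain ⟨v, rfl⟩ := hx
  rintro _ ⟨w, rfl⟩
  exact ⟨w * v⁻¹, by simp [← twConj_mul]⟩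

/-- Rotating a reduced word for a length-minimal element of a quasiparabolic twisted class
through the automorphism gives another word for the same element. -/
theorem IsQPClass.wordProd_rotate {cs : CoxeterSystem M W} {θ : W ≃* W} {𝒦 : Set W}
    (hK : IsTwClass θ 𝒦) (hqp : IsQPClass cs θ 𝒦) {σ : B → B}
    (hσ : ∀ i, θ (cs.simple i) = cs.simple (σ i)) {x : W} (hx : x ∈ 𝒦)
    (hmin : ∀ y ∈ 𝒦, cs.length x ≤ cs.length y) (α β : List B)
    (hprod : cs.wordProd (α ++ β) = x) (hlen : α.length + β.length = cs.length x) :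
    cs.wordProd (β ++ α.map σ) = x ∧ ∀ i ∈ α, cs.IsLeftDescent x i := by
  induction α generalizing β with
  | nil => simpa using hprod
  | cons i α ih =>
    rw [List.cons_append, cs.wordProd_cons] at hprod
    rw [List.length_cons] at hlen
    have hrot : twConj θ (cs.simple i) x = cs.wordProd (α ++ (β ++ [σ i])) := by
      rw [twConj, ← hprod, hσ, cs.inv_simple, cs.simple_mul_simple_cancel_left,
        ← List.append_assoc, cs.wordProd_append (α ++ β), cs.wordProd_singleton]
    have hle : cs.length (twConj θ (cs.simple i) x) ≤ cs.length x := by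
      rw [hrot]
      refine (cs.length_wordProd_le _).trans ?_
      simp only [List.length_append, List.length_singleton]
      omega
    have hfix : twConj θ (cs.simple i) x = x := by
      refine hqp.1 _ (cs.isReflection_simple i) x hx ?_
      rw [htL, htL, hle.antisymm (hmin _ (hK.twConj_mem hx _))]
    obtain ⟨h1, h2⟩ := ih (β ++ [σ i]) (hrot.symm.trans hfix) (by simp; omega)
    refine ⟨by simpa using h1, List.forall_mem_cons.mpr ⟨?_, h2⟩⟩
    rw [CoxeterSystem.IsLeftDescent]
    nth_rewrite 1 [← hprod]
    rw [cs.simple_mul_simple_cancel_left]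
    have := cs.length_wordProd_le (α ++ β)
    rw [List.length_append] at this
    omega

/-- Every quasiparabolic twisted class contains an element `x` with `x·θ(x) = 1`. -/
theorem IsQPClass.exists_mul_map_eq_one {cs : CoxeterSystem M W} {θ : W ≃* W} {𝒦 : Set W}
    (hθS : SimpleOnto cs θ) (hK : IsTwClass θ 𝒦) (hqp : IsQPClass cs θ 𝒦) :
    ∃ x ∈ 𝒦, x * θ x = 1 := by
  have hne : 𝒦.Nonempty := by
    obtain ⟨x₀, rfl⟩ := hK
    exact Set.range_nonempty _
  obtain ⟨x, hx, hmin⟩ : ∃ x ∈ 𝒦, ∀ y ∈ 𝒦, cs.length x ≤ cs.length y := by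
    obtain ⟨x, hx, hmin⟩ := WellFounded.has_min (measure cs.length).wf 𝒦 hne
    exact ⟨x, hx, fun y hy => not_lt.mp (hmin y hy)⟩
  have hS : ∀ i, ∃ k, θ (cs.simple i) = cs.simple k := fun i => by
    obtain ⟨k, hk⟩ := hθS.subset ⟨_, ⟨i, rfl⟩, rfl⟩
    exact ⟨k, hk.symm⟩
  choose σ hσ using hS
  obtain ⟨ω, hω, rfl⟩ := cs.exists_isReduced x
  obtain ⟨hrot, hd⟩ := hqp.wordProd_rotate hK hσ hx hmin ω [] (by simp) (by simpa using hω.eq.symm)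
  refine ⟨_, hx, ?_⟩
  have hθ : θ (cs.wordProd ω) = cs.wordProd ω := by
    rw [List.nil_append] at hrot
    nth_rewrite 2 [← hrot]
    simp [CoxeterSystem.wordProd, map_list_prod, Function.comp_def, hσ]
  rw [hθ]
  exact hω.wordProd_mul_self hd

/-- If `𝒦` is a quasiparabolic `θ`-twisted conjugacy class, then the map
`x ↦ x·θ(x)` is a surjection from `𝒦` onto the set of `θ²`-twisted identities
`{y⁻¹·θ²(y) : y ∈ W}`. -/
theorem stmt13 (cs : CoxeterSystem M W) (θ : W ≃* W) (hθS : SimpleOnto cs θ)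
    (𝒦 : Set W) (hK : IsTwClass θ 𝒦) (hqp : IsQPClass cs θ 𝒦) :
    (fun x => x * θ x) '' 𝒦 = Set.range fun y : W => y⁻¹ * θ (θ y) := by
  obtain ⟨x, hx, hx1⟩ := hqp.exists_mul_map_eq_one hθS hK
  have key (w : W) : twConj θ w x * θ (twConj θ w x) = w * (θ (θ w))⁻¹ := by
    calc twConj θ w x * θ (twConj θ w x) = w * (x * θ x) * (θ (θ w))⁻¹ := by
          simp [twConj, mul_assoc]
      _ = w * (θ (θ w))⁻¹ := by rw [hx1, mul_one]
  rw [hK.eq_range hx, ← Set.range_comp, ← (Equiv.inv W).surjective.range_comp]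
  congr 1
  funext w
  simp [key]


end
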